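/- arXiv:1207.0827 — 4 statements merged into one kernel-verified Lean document; each statement's English description precedes it below -/
import Mathlib

section
/- Let X and Y be topological spaces and F ⊆ Y^X a family of functions. Then F is scatteredly continuous (respectively, weakly discontinuous) if and only if the diagonal product ΔF : X → Y^F, x ↦ (f(x))_{f∈F}, is a scatteredly continuous (respectively, weakly discontinuous) function. Consequently, if Y is a regular topological space, then F is scatteredly continuous if and only if F is weakly discontinuous. -/
open Filter Topology Set Pointwise

universe u v

section Defs

variable {X : Type u} {Y : Type v} [TopologicalSpace X] [TopologicalSpace Y]

/-- A function is scatteredly continuous if its restriction to every nonempty subset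
has a point of continuity. -/
def ScatteredlyContinuous (f : X → Y) : Prop :=
  ∀ A : Set X, A.Nonempty → ∃ a ∈ A, ContinuousWithinAt f A a

/-- A function is weakly discontinuous if every nonempty subset `A` contains a
relatively open, relatively dense subset `U` on which the function is continuous. -/
def WeaklyDiscontinuous (f : X → Y) : Prop :=
  ∀ A : Set X, A.Nonempty → ∃ U ⊆ A, (∃ V : Set X, IsOpen V ∧ U = V ∩ A) ∧
    A ⊆ closure U ∧ ContinuousOn f U

/-- A function family is scatteredly continuous if each nonempty subset `A ⊆ X`
contains a point at which every `f|A`, `f ∈ F`, is continuous. -/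
def ScatteredlyContinuousFamily (F : Set (X → Y)) : Prop :=
  ∀ A : Set X, A.Nonempty → ∃ a ∈ A, ∀ f ∈ F, ContinuousWithinAt f A a

/-- A function family is weakly discontinuous if each nonempty subset `A ⊆ X` contains
a relatively open, relatively dense subset `U` such that `f|U` is continuous for every `f ∈ F`. -/
def WeaklyDiscontinuousFamily (F : Set (X → Y)) : Prop :=
  ∀ A : Set X, A.Nonempty → ∃ U ⊆ A, (∃ V : Set X, IsOpen V ∧ U = V ∩ A) ∧
    A ⊆ closure U ∧ ∀ f ∈ F, ContinuousOn f U

/-- Countable tightness. -/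
def CountablyTight (X : Type u) [TopologicalSpace X] : Prop :=
  ∀ A : Set X, ∀ a ∈ closure A, ∃ B ⊆ A, B.Countable ∧ a ∈ closure B

/-- Countable strong fan tightness. -/
def CountableStrongFanTightness (X : Type u) [TopologicalSpace X] : Prop :=
  ∀ A : ℕ → Set X, ∀ a : X, (∀ n, a ∈ closure (A n)) →
    ∃ x : ℕ → X, (∀ n, x n ∈ A n) ∧ a ∈ closure (Set.range x)

/-- A network of a topological space. -/
def IsNetwork {Z : Type*} [TopologicalSpace Z] (N : Set (Set Z)) : Prop :=
  ∀ z : Z, ∀ U : Set Z, IsOpen U → z ∈ U → ∃ s ∈ N, z ∈ s ∧ s ⊆ U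

/-- The network weight of a topological space. -/
noncomputable def networkWeight (Z : Type u) [TopologicalSpace Z] : Cardinal.{u} :=
  sInf { c | ∃ N : Set (Set Z), IsNetwork N ∧ c = Cardinal.mk N }

/-- The weight of a topological space: the smallest cardinality of a base. -/
noncomputable def topWeight (Z : Type u) [TopologicalSpace Z] : Cardinal.{u} :=
  sInf { c | ∃ B : Set (Set Z), TopologicalSpace.IsTopologicalBasis B ∧ c = Cardinal.mk B }

/-- The decomposition number of a function family: the smallest cardinality of a cover of `X`
by sets on each of which every member of the family is continuous. -/
noncomputable def decNumber (F : Set (X → Y)) : Cardinal.{u} :=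
  sInf { c | ∃ C : Set (Set X), ⋃₀ C = Set.univ ∧
    (∀ s ∈ C, ∀ f ∈ F, ContinuousOn f s) ∧ c = Cardinal.mk C }

/-- The closed decomposition number: as `decNumber` but with covers by closed or finite sets. -/
noncomputable def decClNumber (F : Set (X → Y)) : Cardinal.{u} :=
  sInf { c | ∃ C : Set (Set X), ⋃₀ C = Set.univ ∧ (∀ s ∈ C, IsClosed s ∨ s.Finite) ∧
    (∀ s ∈ C, ∀ f ∈ F, ContinuousOn f s) ∧ c = Cardinal.mk C }

/-- The Lindelöf number: the smallest infinite cardinal `κ` such that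
every open cover has a subcover of cardinality at most `κ`. -/
noncomputable def lindelofNumber (Z : Type u) [TopologicalSpace Z] : Cardinal.{u} :=
  sInf { c | Cardinal.aleph0 ≤ c ∧ ∀ U : Set (Set Z), (∀ u ∈ U, IsOpen u) → ⋃₀ U = Set.univ →
    ∃ V ⊆ U, Cardinal.mk V ≤ c ∧ ⋃₀ V = Set.univ }

/-- The hereditary Lindelöf number: the supremum of Lindelöf numbers of subspaces. -/
noncomputable def hereditaryLindelofNumber (Z : Type u) [TopologicalSpace Z] : Cardinal.{u} :=
  ⨆ A : Set Z, lindelofNumber ↥A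

/-- The spread: the smallest infinite cardinal bounding cardinalities of discrete subspaces. -/
noncomputable def spread (Z : Type u) [TopologicalSpace Z] : Cardinal.{u} :=
  sInf { c | Cardinal.aleph0 ≤ c ∧ ∀ D : Set Z, DiscreteTopology ↥D → Cardinal.mk ↥D ≤ c }

/-- The compact density: the smallest cardinality of a family of compact sets with dense union. -/
noncomputable def compactDensity (Z : Type u) [TopologicalSpace Z] : Cardinal.{u} :=
  sInf { c | ∃ K : Set (Set Z), (∀ k ∈ K, IsCompact k) ∧ Dense (⋃₀ K) ∧ c = Cardinal.mk K }

/-- The closed hereditary compact density: the supremum of `compactDensity` over closed subspaces. -/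
noncomputable def hclCompactDensity (Z : Type u) [TopologicalSpace Z] : Cardinal.{u} :=
  ⨆ F : {F : Set Z // IsClosed F}, compactDensity ↥F.1

/-- Convergence of the series `∑ x n` to `y` (convergence of the partial sums). -/
def SeriesConvTo {M : Type*} [AddCommMonoid M] [TopologicalSpace M] (x : ℕ → M) (y : M) : Prop :=
  Filter.Tendsto (fun N => ∑ n ∈ Finset.range N, x n) Filter.atTop (nhds y)

section TVS

variable {L : Type*} [AddCommGroup L] [Module ℝ L] [TopologicalSpace L]

/-- A subset `B` of a topological vector space is bounded if for every neighborhood `U` of `0`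
there is `n ∈ ℕ` with `B ⊆ n • U`. -/
def TVSBounded (B : Set L) : Prop :=
  ∀ U ∈ nhds (0 : L), ∃ n : ℕ, B ⊆ (n : ℝ) • U

/-- `K` is ∞-convex if for every bounded sequence in `K` and nonnegative coefficients summing
to `1`, the corresponding series converges to a point of `K`. -/
def InftyConvex (K : Set L) : Prop :=
  ∀ x : ℕ → L, (∀ n, x n ∈ K) → TVSBounded (Set.range x) →
    ∀ t : ℕ → ℝ, (∀ n, 0 ≤ t n) → SeriesConvTo t 1 →
      ∃ y ∈ K, SeriesConvTo (fun n => t n • x n) y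

/-- `K` is σ-convex if for every sequence in `K` and nonnegative coefficients summing
to `1`, the corresponding series converges to a point of `K`. -/
def SigmaConvex (K : Set L) : Prop :=
  ∀ x : ℕ → L, (∀ n, x n ∈ K) →
    ∀ t : ℕ → ℝ, (∀ n, 0 ≤ t n) → SeriesConvTo t 1 →
      ∃ y ∈ K, SeriesConvTo (fun n => t n • x n) y

/-- `B` is potentially bounded if every sequence in `B` can be rescaled by positive reals
to become a bounded set. -/
def PotentiallyBounded (B : Set L) : Prop :=
  ∀ x : ℕ → L, (∀ n, x n ∈ B) →
    ∃ t : ℕ → ℝ, (∀ n, 0 < t n) ∧ TVSBounded (Set.range fun n => t n • x n)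

/-- A Cauchy sequence in a topological additive group. -/
def SeqCauchy (u : ℕ → L) : Prop :=
  ∀ U ∈ nhds (0 : L), ∃ N : ℕ, ∀ m ≥ N, ∀ n ≥ N, u m - u n ∈ U

/-- A set is sequentially complete if every Cauchy sequence of its points converges
to a point of the set. -/
def SeqCompleteSet (B : Set L) : Prop :=
  ∀ u : ℕ → L, (∀ n, u n ∈ B) → SeqCauchy u → ∃ y ∈ B, Filter.Tendsto u Filter.atTop (nhds y)

end TVS

/-- The set of scatteredly continuous real-valued functions on `X`. -/
def SCp (X : Type u) [TopologicalSpace X] : Set (X → ℝ) :=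
  {f | ScatteredlyContinuous f}

/-- The set of bounded scatteredly continuous real-valued functions on `X`. -/
def SCpStar (X : Type u) [TopologicalSpace X] : Set (X → ℝ) :=
  {f | ScatteredlyContinuous f ∧ ∃ M : ℝ, ∀ x, |f x| ≤ M}

/-- A subset is scattered if each of its nonempty subsets has a relatively isolated point. -/
def IsScatteredSet (S : Set X) : Prop :=
  ∀ A ⊆ S, A.Nonempty → ∃ a ∈ A, ∃ V : Set X, IsOpen V ∧ V ∩ A = {a}

/-- `D` is a dense subset of the subspace `Z`. -/
def DenseIn (D Z : Set X) : Prop := D ⊆ Z ∧ Z ⊆ closure D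

/-- The subspace `Z` is R-separable. -/
def RSeparableSet (Z : Set X) : Prop :=
  ∀ D : ℕ → Set X, (∀ n, DenseIn (D n) Z) →
    ∃ x : ℕ → X, (∀ n, x n ∈ D n) ∧ Z ⊆ closure (Set.range x)

/-- `X` is countably R-separable: each countable subspace is R-separable. -/
def CountablyRSeparable (X : Type u) [TopologicalSpace X] : Prop :=
  ∀ Z : Set X, Z.Countable → RSeparableSet Z

/-- `X` is scatteredly R-separable. -/
def ScatteredlyRSeparable (X : Type u) [TopologicalSpace X] : Prop :=
  ∀ Z : Set X, Z.Countable → (∀ z ∈ Z, ¬∃ V : Set X, IsOpen V ∧ V ∩ Z = {z}) →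
    ∀ D : ℕ → Set X, (∀ n, DenseIn (D n) Z) →
      ∃ x : ℕ → X, (∀ n, x n ∈ D n) ∧ ¬ IsScatteredSet (Set.range x)

end Defs
theorem WeaklyDiscontinuousFamily.scatteredlyContinuousFamily {X : Type*} {Y : Type*}
    [TopologicalSpace X] [TopologicalSpace Y] {F : Set (X → Y)}
    (hF : WeaklyDiscontinuousFamily F) : ScatteredlyContinuousFamily F := by
  rintro A hA
  obtain ⟨U, -, ⟨V, hV, rfl⟩, hAU, hc⟩ := hF A hA
  obtain ⟨a, haV, haA⟩ := closure_nonempty_iff.1 (hA.mono hAU)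
  refine ⟨a, haA, fun f hf => ?_⟩
  exact (continuousWithinAt_inter' (mem_nhdsWithin_of_mem_nhds (hV.mem_nhds haV))).1
    (inter_comm V A ▸ hc f hf a ⟨haV, haA⟩)

/-- If the discontinuity points of `f|A` are dense in `A`, then a continuity point of the
restriction of `f` to them is a continuity point of `f|A`. -/
theorem continuousWithinAt_of_dense_discontinuities {X : Type*} {Z : Type*}
    [TopologicalSpace X] [TopologicalSpace Z] [RegularSpace Z] {f : X → Z} {A : Set X} {a : X}
    (hdense : A ⊆ closure {x ∈ A | ¬ ContinuousWithinAt f A x})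
    (ha : ContinuousWithinAt f {x ∈ A | ¬ ContinuousWithinAt f A x} a) :
    ContinuousWithinAt f A a := by
  intro O hO
  obtain ⟨K, hK, hKc, hKO⟩ := exists_mem_nhds_isClosed_subset hO
  obtain ⟨W, hW, haW, hWK⟩ := mem_nhdsWithin.1 (ha hK)
  refine mem_nhdsWithin.2 ⟨W, hW, haW, fun x ⟨hxW, hxA⟩ => hKO ?_⟩
  by_cases hx : ContinuousWithinAt f A x
  · have hxcl : x ∈ closure (W ∩ {x ∈ A | ¬ ContinuousWithinAt f A x}) :=
      hW.inter_closure ⟨hxW, hdense hxA⟩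
    exact hKc.closure_subset_iff.2 (image_subset_iff.2 hWK)
      ((hx.mono fun y hy => hy.2.1).mem_closure_image hxcl)
  · exact hWK ⟨hxW, hxA, hx⟩

theorem ScatteredlyContinuous.exists_isOpen_continuousOn {X : Type*} {Z : Type*}
    [TopologicalSpace X] [TopologicalSpace Z] [RegularSpace Z] {f : X → Z}
    (hf : ScatteredlyContinuous f) {A : Set X} (hA : A.Nonempty) :
    ∃ V, IsOpen V ∧ (V ∩ A).Nonempty ∧ ContinuousOn f (V ∩ A) := by
  by_cases hdense : A ⊆ closure {x ∈ A | ¬ ContinuousWithinAt f A x}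
  · obtain ⟨a, ha, hac⟩ := hf _ (closure_nonempty_iff.1 (hA.mono hdense))
    exact absurd (continuousWithinAt_of_dense_discontinuities hdense hac) ha.2
  · obtain ⟨x, hxA, hx⟩ := not_subset.1 hdense
    refine ⟨_, isClosed_closure.isOpen_compl, ⟨x, hx, hxA⟩, fun y ⟨hy, hyA⟩ => ?_⟩
    by_contra hyc
    exact hy (subset_closure ⟨hyA, fun h => hyc (h.mono inter_subset_right)⟩)

/-- A scatteredly continuous function into a regular space is weakly discontinuous. -/
theorem ScatteredlyContinuous.weaklyDiscontinuous {X : Type*} {Z : Type*}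
    [TopologicalSpace X] [TopologicalSpace Z] [RegularSpace Z] {f : X → Z}
    (hf : ScatteredlyContinuous f) : WeaklyDiscontinuous f := by
  intro A _
  have hopen : IsOpen (⋃₀ {V | IsOpen V ∧ ContinuousOn f (V ∩ A)}) :=
    isOpen_sUnion fun V hV => hV.1
  refine ⟨_, inter_subset_right, ⟨_, hopen, rfl⟩, fun a ha => ?_, ?_⟩
  · refine mem_closure_iff.2 fun W hW haW => ?_
    obtain ⟨V, hV, ⟨x, hxV, hxW, hxA⟩, hc⟩ :=
      hf.exists_isOpen_continuousOn (A := W ∩ A) ⟨a, haW, ha⟩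
    exact ⟨x, hxW, ⟨V ∩ W, ⟨hV.inter hW, by rwa [inter_assoc]⟩, hxV, hxW⟩, hxA⟩
  · rintro x ⟨⟨V, ⟨hV, hc⟩, hxV⟩, hxA⟩
    have hx : ContinuousWithinAt f A x :=
      (continuousWithinAt_inter' (mem_nhdsWithin_of_mem_nhds (hV.mem_nhds hxV))).1
        (inter_comm V A ▸ hc x ⟨hxV, hxA⟩)
    exact hx.mono inter_subset_right

theorem scatteredlyContinuousFamily_iff_diag {X : Type*} {Y : Type*}
    [TopologicalSpace X] [TopologicalSpace Y] (F : Set (X → Y)) :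
    ScatteredlyContinuousFamily F ↔ ScatteredlyContinuous (fun x (f : F) => f.1 x) := by
  simp only [ScatteredlyContinuousFamily, ScatteredlyContinuous, continuousWithinAt_pi,
    Subtype.forall]

theorem weaklyDiscontinuousFamily_iff_diag {X : Type*} {Y : Type*}
    [TopologicalSpace X] [TopologicalSpace Y] (F : Set (X → Y)) :
    WeaklyDiscontinuousFamily F ↔ WeaklyDiscontinuous (fun x (f : F) => f.1 x) := by
  simp only [WeaklyDiscontinuousFamily, WeaklyDiscontinuous, continuousOn_pi, Subtype.forall]

/-- A function family `F ⊆ Y^X` is scatteredly continuous (resp. weakly discontinuous) iff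
so is its diagonal product `ΔF : X → Y^F`; consequently, for a regular space `Y`, a family
is scatteredly continuous iff it is weakly discontinuous. -/
theorem scatteredlyContinuousFamily_iff_diag_and_regular
    {X : Type u} {Y : Type v} [TopologicalSpace X] [TopologicalSpace Y] (F : Set (X → Y)) :
    (ScatteredlyContinuousFamily F ↔ ScatteredlyContinuous (fun x (f : F) => f.1 x)) ∧
    (WeaklyDiscontinuousFamily F ↔ WeaklyDiscontinuous (fun x (f : F) => f.1 x)) ∧
    (RegularSpace Y → (ScatteredlyContinuousFamily F ↔ WeaklyDiscontinuousFamily F)) := by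
  refine ⟨scatteredlyContinuousFamily_iff_diag F, weaklyDiscontinuousFamily_iff_diag F,
    fun _ => ⟨fun h => ?_, WeaklyDiscontinuousFamily.scatteredlyContinuousFamily⟩⟩
  exact (weaklyDiscontinuousFamily_iff_diag F).2
    ((scatteredlyContinuousFamily_iff_diag F).1 h).weaklyDiscontinuous
end

section
/- For any topological space X and each weakly discontinuous family F of scatteredly continuous real-valued functions on X, one has dec(F) ≤ hl(X); if moreover X is regular, then also dec_cl(F) ≤ hl(X). -/
open Filter Topology Set Pointwise

universe u v

/-- The infimum defining the Lindelöf number is attained. -/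
theorem lindelofNumber_spec (Z : Type u) [TopologicalSpace Z] :
    Cardinal.aleph0 ≤ lindelofNumber Z ∧ ∀ U : Set (Set Z), (∀ u ∈ U, IsOpen u) →
      ⋃₀ U = Set.univ → ∃ V ⊆ U, Cardinal.mk V ≤ lindelofNumber Z ∧ ⋃₀ V = Set.univ := by
  refine csInf_mem (s := { c : Cardinal.{u} | Cardinal.aleph0 ≤ c ∧ ∀ U : Set (Set Z),
    (∀ u ∈ U, IsOpen u) → ⋃₀ U = Set.univ →
      ∃ V ⊆ U, Cardinal.mk V ≤ c ∧ ⋃₀ V = Set.univ })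
    ⟨max Cardinal.aleph0 (Cardinal.mk (Set Z)), le_max_left _ _, fun U _ hU => ?_⟩
  exact ⟨U, Subset.rfl, (Cardinal.mk_set_le U).trans (le_max_right _ _), hU⟩

theorem lindelofNumber_le_hereditaryLindelofNumber {Z : Type u} [TopologicalSpace Z]
    (A : Set Z) : lindelofNumber A ≤ hereditaryLindelofNumber Z :=
  le_ciSup (f := fun A : Set Z => lindelofNumber A) Cardinal.bddAbove_of_small A

theorem aleph0_le_hereditaryLindelofNumber (Z : Type u) [TopologicalSpace Z] :
    Cardinal.aleph0 ≤ hereditaryLindelofNumber Z :=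
  (lindelofNumber_spec (∅ : Set Z)).1.trans (lindelofNumber_le_hereditaryLindelofNumber _)

/-- Any family of open sets has a subfamily of cardinality at most the hereditary Lindelöf
number with the same union. -/
theorem exists_subfamily_sUnion_eq {Z : Type u} [TopologicalSpace Z] (U : Set (Set Z))
    (hU : ∀ u ∈ U, IsOpen u) :
    ∃ V ⊆ U, Cardinal.mk V ≤ hereditaryLindelofNumber Z ∧ ⋃₀ V = ⋃₀ U := by
  obtain ⟨V, hVU, hVcard, hV⟩ := (lindelofNumber_spec (⋃₀ U : Set Z)).2
    ((fun u => (Subtype.val ⁻¹' u : Set (⋃₀ U : Set Z))) '' U)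
    (by
      rintro _ ⟨u, hu, rfl⟩
      exact (hU u hu).preimage continuous_subtype_val)
    (by
      refine eq_univ_of_forall ?_
      rintro ⟨x, u, hu, hxu⟩
      exact ⟨_, ⟨u, hu, rfl⟩, hxu⟩)
  choose g hgU hg using fun v : V => hVU v.2
  refine ⟨range g, range_subset_iff.2 hgU, Cardinal.mk_range_le.trans
    (hVcard.trans (lindelofNumber_le_hereditaryLindelofNumber _)),
    Subset.antisymm (sUnion_subset_sUnion (range_subset_iff.2 hgU)) fun x hx => ?_⟩
  obtain ⟨v, hv, hxv⟩ : (⟨x, hx⟩ : (⋃₀ U : Set Z)) ∈ ⋃₀ V := hV ▸ mem_univ _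
  refine ⟨g ⟨v, hv⟩, mem_range_self _, ?_⟩
  rw [← show _ = v from hg ⟨v, hv⟩] at hxv
  exact hxv

/-- If every nonempty closed set has a nonempty relatively open part lying in a set satisfying
`P`, then the space is covered by at most hereditary Lindelöf number many sets satisfying `P`. -/
theorem exists_cover_mk_le_hereditaryLindelofNumber {Z : Type u} [TopologicalSpace Z]
    (P : Set Z → Prop)
    (hP : ∀ A : Set Z, IsClosed A → A.Nonempty →
      ∃ V s : Set Z, IsOpen V ∧ (V ∩ A).Nonempty ∧ V ∩ A ⊆ s ∧ P s) :
    ∃ C : Set (Set Z), ⋃₀ C = Set.univ ∧ (∀ s ∈ C, P s) ∧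
      Cardinal.mk C ≤ hereditaryLindelofNumber Z := by
  set κ := hereditaryLindelofNumber Z
  have hκ : Cardinal.aleph0 ≤ κ := aleph0_le_hereditaryLindelofNumber Z
  let G : Set (Set Z) := {W | IsOpen W ∧ ∃ C : Set (Set Z), W ⊆ ⋃₀ C ∧ (∀ s ∈ C, P s) ∧
    Cardinal.mk C ≤ κ}
  obtain ⟨V, hVG, hVcard, hV⟩ := exists_subfamily_sUnion_eq G fun W hW => hW.1
  choose C hWC hCP hCcard using fun W : V => (hVG W.2).2
  have hsub : ⋃₀ G ⊆ ⋃₀ ⋃ W, C W := by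
    rw [← hV]
    rintro x ⟨W, hW, hx⟩
    obtain ⟨s, hs, hxs⟩ := hWC ⟨W, hW⟩ hx
    exact ⟨s, mem_iUnion.2 ⟨_, hs⟩, hxs⟩
  have hP' : ∀ s ∈ ⋃ W, C W, P s := fun s hs => by
    obtain ⟨W, hs⟩ := mem_iUnion.1 hs
    exact hCP W s hs
  have hcard : Cardinal.mk (⋃ W, C W : Set (Set Z)) ≤ κ :=
    (Cardinal.mk_iUnion_le _).trans <|
      (mul_le_mul' hVcard (ciSup_le' hCcard)).trans (Cardinal.mul_eq_self hκ).le
  have hopen : IsOpen (⋃₀ G) := isOpen_sUnion fun W hW => hW.1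
  have huniv : ⋃₀ G = univ := by
    by_contra hne
    obtain ⟨N, s, hN, ⟨x, hxN, hxG⟩, hNs, hs⟩ :=
      hP (⋃₀ G)ᶜ hopen.isClosed_compl (nonempty_compl.2 hne)
    refine hxG ⟨⋃₀ G ∪ N, ⟨hopen.union hN, insert s (⋃ W, C W), ?_, ?_, ?_⟩, Or.inr hxN⟩
    · intro y hy
      rw [sUnion_insert]
      by_cases hyG : y ∈ ⋃₀ G
      · exact Or.inr (hsub hyG)
      · exact Or.inl (hNs ⟨hy.resolve_left hyG, hyG⟩)
    · exact forall_mem_insert.2 ⟨hs, hP'⟩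
    · exact Cardinal.mk_insert_le.trans
        (Cardinal.add_le_of_le hκ hcard (Cardinal.one_le_aleph0.trans hκ))
  exact ⟨_, univ_subset_iff.1 (huniv ▸ hsub), hP', hcard⟩

/-- For any topological space `X` and each weakly discontinuous family `F ⊆ SC_p(X)`,
`dec(F) ≤ hl(X)`; and if `X` is regular, also `dec_cl(F) ≤ hl(X)`. -/
theorem decNumber_le_hereditaryLindelofNumber
    {X : Type u} [TopologicalSpace X] (F : Set (X → ℝ)) (hFsub : F ⊆ SCp X)
    (hF : WeaklyDiscontinuousFamily F) :
    decNumber F ≤ hereditaryLindelofNumber X ∧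
    (RegularSpace X → decClNumber F ≤ hereditaryLindelofNumber X) := by
  have key : ∀ A : Set X, A.Nonempty → ∃ V : Set X, IsOpen V ∧ (V ∩ A).Nonempty ∧
      ∀ f ∈ F, ContinuousOn f (V ∩ A) := by
    intro A hA
    obtain ⟨_, -, ⟨V, hV, rfl⟩, hd, hc⟩ := hF A hA
    exact ⟨V, hV, closure_nonempty_iff.1 (hA.mono hd), hc⟩
  refine ⟨?_, fun _ => ?_⟩
  · obtain ⟨C, hCu, hC, hcard⟩ := exists_cover_mk_le_hereditaryLindelofNumber
      (fun s : Set X => ∀ f ∈ F, ContinuousOn f s) fun A _ hne => by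
        obtain ⟨V, hV, hVne, hc⟩ := key A hne
        exact ⟨V, V ∩ A, hV, hVne, Subset.rfl, hc⟩
    exact le_trans (csInf_le' ⟨C, hCu, hC, rfl⟩) hcard
  · obtain ⟨C, hCu, hC, hcard⟩ := exists_cover_mk_le_hereditaryLindelofNumber
      (fun s : Set X => IsClosed s ∧ ∀ f ∈ F, ContinuousOn f s) fun A hA hne => by
        obtain ⟨V, hV, ⟨x, hxV, hxA⟩, hc⟩ := key A hne
        obtain ⟨K, hK, hKc, hKV⟩ := exists_mem_nhds_isClosed_subset (hV.mem_nhds hxV)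
        exact ⟨interior K, K ∩ A, isOpen_interior, ⟨x, mem_interior_iff_mem_nhds.2 hK, hxA⟩,
          inter_subset_inter_left A interior_subset, hKc.inter hA,
          fun f hf => (hc f hf).mono (inter_subset_inter_left A hKV)⟩
    exact le_trans (csInf_le' ⟨C, hCu, fun s hs => Or.inl (hC s hs).1,
      fun s hs => (hC s hs).2, rfl⟩) hcard
end

section
/- Let X be a σ-compact topological space. Then every family F of real-valued functions on X with dec_cl(F) ≤ ℵ₀ is potentially bounded in ℝ^X (with the product topology). -/
open Filter Topology Set Pointwise

universe u v

/-- The infimum defining the closed decomposition number is attained. -/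
theorem exists_cover_of_decClNumber {X : Type u} {Y : Type v} [TopologicalSpace X]
    [TopologicalSpace Y] (F : Set (X → Y)) :
    ∃ C : Set (Set X), ⋃₀ C = Set.univ ∧ (∀ s ∈ C, IsClosed s ∨ s.Finite) ∧
      (∀ s ∈ C, ∀ f ∈ F, ContinuousOn f s) ∧ decClNumber F = Cardinal.mk C := by
  refine csInf_mem (s := { c | ∃ C : Set (Set X), ⋃₀ C = Set.univ ∧
    (∀ s ∈ C, IsClosed s ∨ s.Finite) ∧
    (∀ s ∈ C, ∀ f ∈ F, ContinuousOn f s) ∧ c = Cardinal.mk C }) ?_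
  refine ⟨_, Set.range (fun x : X => ({x} : Set X)), ?_, ?_, ?_, rfl⟩
  · exact Set.eq_univ_of_forall fun x => ⟨{x}, ⟨x, rfl⟩, rfl⟩
  · rintro _ ⟨x, rfl⟩
    exact Or.inr (Set.finite_singleton x)
  · rintro _ ⟨x, rfl⟩ f _
    exact continuousOn_singleton f x

/-- If the space is a countable union of sets on each of which every member of the sequence `x`
is bounded, then `x` can be rescaled to a pointwise bounded sequence. -/
theorem exists_pos_smul_pointwise_bounded {X : Type*} (D : ℕ → Set X)
    (hD : ∀ y, ∃ i, y ∈ D i) (x : ℕ → X → ℝ)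
    (hx : ∀ n i, ∃ M : ℝ, ∀ y ∈ D i, |x n y| ≤ M) :
    ∃ t : ℕ → ℝ, (∀ n, 0 < t n) ∧ ∀ y, ∃ R : ℝ, ∀ n, |t n * x n y| ≤ R := by
  choose M hM using hx
  have hpos : ∀ n, 0 < 1 + ∑ i ∈ Finset.range (n + 1), |M n i| := fun n => by positivity
  refine ⟨fun n => (1 + ∑ i ∈ Finset.range (n + 1), |M n i|)⁻¹,
    fun n => inv_pos.2 (hpos n), fun y => ?_⟩
  obtain ⟨i, hi⟩ := hD y
  have hev : ∀ n ≥ i, |(1 + ∑ i ∈ Finset.range (n + 1), |M n i|)⁻¹ * x n y| ≤ 1 := by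
    intro n hn
    rw [abs_mul, abs_of_pos (inv_pos.2 (hpos n)), inv_mul_le_one₀ (hpos n)]
    have h₁ : |M n i| ≤ ∑ i ∈ Finset.range (n + 1), |M n i| :=
      Finset.single_le_sum (f := fun i => |M n i|) (fun _ _ => abs_nonneg _)
        (Finset.mem_range.2 (by omega))
    linarith [hM n i y hi, le_abs_self (M n i)]
  obtain ⟨R, hR⟩ := Filter.IsBoundedUnder.bddAbove_range
    (f := fun n => |(1 + ∑ i ∈ Finset.range (n + 1), |M n i|)⁻¹ * x n y|)
    ⟨1, Filter.eventually_map.2 (Filter.eventually_atTop.2 ⟨i, hev⟩)⟩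
  exact ⟨R, fun n => hR ⟨n, rfl⟩⟩

/-- A pointwise bounded family of real functions is bounded in the product topology. -/
theorem tvsBounded_of_pointwise_bounded {X : Type*} {B : Set (X → ℝ)}
    (hB : ∀ y, ∃ R : ℝ, ∀ f ∈ B, |f y| ≤ R) : TVSBounded B := by
  have hvn : Bornology.IsVonNBounded ℝ B := by
    refine Bornology.isVonNBounded_pi_iff.2 fun y => ?_
    obtain ⟨R, hR⟩ := hB y
    refine (NormedSpace.isVonNBounded_iff ℝ).2 (isBounded_iff_forall_norm_le.2 ⟨R, ?_⟩)
    rintro _ ⟨f, hf, rfl⟩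
    exact hR f hf
  intro U hU
  exact ((tendsto_natCast_atTop_cobounded (α := ℝ)).eventually (hvn hU)).exists

/-- For a σ-compact topological space `X`, each function family `F ⊆ ℝ^X` with
`dec_cl(F) ≤ ℵ₀` is potentially bounded in `ℝ^X`. -/
theorem potentiallyBounded_of_decClNumber_le_aleph0
    {X : Type u} [TopologicalSpace X] [SigmaCompactSpace X]
    (F : Set (X → ℝ)) (h : decClNumber F ≤ Cardinal.aleph0) :
    PotentiallyBounded F := by
  obtain ⟨C, hCu, hC, hCF, hcard⟩ := exists_cover_of_decClNumber F
  have hCc : C.Countable := Cardinal.mk_le_aleph0_iff.1 (hcard ▸ h)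
  obtain ⟨g, hg⟩ := (hCc.insert ∅).exists_eq_range (Set.insert_nonempty _ _)
  intro x hx
  have hcover : ∀ y, ∃ k : ℕ, y ∈ g k.unpair.1 ∩ compactCovering X k.unpair.2 := by
    intro y
    obtain ⟨s, hs, hys⟩ : y ∈ ⋃₀ C := hCu ▸ Set.mem_univ y
    obtain ⟨m, rfl⟩ : s ∈ Set.range g := hg ▸ Set.mem_insert_of_mem _ hs
    obtain ⟨j, hj⟩ := exists_mem_compactCovering y
    exact ⟨Nat.pair m j, by simpa using ⟨hys, hj⟩⟩
  have hbound : ∀ n (k : ℕ), ∃ M : ℝ,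
      ∀ y ∈ g k.unpair.1 ∩ compactCovering X k.unpair.2, |x n y| ≤ M := by
    intro n k
    have hK := isCompact_compactCovering X k.unpair.2
    have hmem : g k.unpair.1 ∈ insert ∅ C := hg ▸ Set.mem_range_self _
    have hcomp : IsCompact (g k.unpair.1 ∩ compactCovering X k.unpair.2) := by
      rcases hmem with h₀ | hs
      · simp [h₀]
      · rcases hC _ hs with hcl | hfin
        · exact hK.inter_left hcl
        · exact (hfin.inter_of_left _).isCompact
    have hcont : ContinuousOn (x n) (g k.unpair.1 ∩ compactCovering X k.unpair.2) := by
      rcases hmem with h₀ | hs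
      · simp [h₀]
      · exact (hCF _ hs _ (hx n)).mono Set.inter_subset_left
    exact hcomp.exists_bound_of_continuousOn hcont
  obtain ⟨t, ht, hb⟩ := exists_pos_smul_pointwise_bounded _ hcover x hbound
  refine ⟨t, ht, tvsBounded_of_pointwise_bounded fun y => ?_⟩
  obtain ⟨R, hR⟩ := hb y
  refine ⟨R, ?_⟩
  rintro _ ⟨n, rfl⟩
  exact hR n
end

section
/- For a perfectly normal compact Hausdorff space X, each compact convex subset of the function space SC_p(X) is metrizable. -/
open Filter Topology Set Pointwise

universe u v

/-- If a family of continuous linear functionals on a Banach space fails to converge to `0` at some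
vector, then the vectors at which it does converge to `0` form a meagre set. -/
theorem isMeagre_setOf_tendsto_zero {E ι : Type*} [NormedAddCommGroup E] [NormedSpace ℝ E]
    [CompleteSpace E] {l : Filter ι} [l.IsCountablyGenerated] (T : ι → E →L[ℝ] ℝ)
    {s₀ : E} (hs₀ : ¬ Tendsto (fun x => T x s₀) l (𝓝 0)) :
    IsMeagre {s | Tendsto (fun x => T x s) l (𝓝 0)} := by
  by_contra hL
  obtain ⟨U, hU⟩ := l.exists_antitone_basis
  let C : ℕ → Set E := fun k => {s | ∀ x ∈ U k, |T x s| ≤ 1}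
  have hCclosed : ∀ k, IsClosed (C k) := fun k => by
    simp only [C, ofPred_forall]
    exact isClosed_biInter fun x _ => isClosed_le (T x).continuous.abs continuous_const
  have hLC : {s | Tendsto (fun x => T x s) l (𝓝 0)} ⊆ ⋃ k, C k := fun s hs => by
    have h1 : ∀ᶠ x in l, |T x s| ≤ 1 := by
      have := (Metric.tendsto_nhds.1 hs) 1 one_pos
      filter_upwards [this] with x hx
      simpa [Real.dist_eq] using hx.le
    obtain ⟨k, hk⟩ := hU.mem_iff.1 h1
    exact mem_iUnion.2 ⟨k, fun x hx => hk hx⟩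
  obtain ⟨k, s₁, hs₁⟩ : ∃ k, (interior (C k)).Nonempty := by
    by_contra! h
    exact hL ((isMeagre_iUnion fun k =>
      (((hCclosed k).isNowhereDense_iff).2 (h k)).isMeagre).mono hLC)
  obtain ⟨δ, hδ, hball⟩ := Metric.isOpen_iff.1 isOpen_interior s₁ hs₁
  have hbound : ∀ x ∈ U k, ∀ s : E, ‖s‖ < δ → |T x s| ≤ 2 := fun x hx s hs => by
    have h1 := interior_subset hs₁ x hx
    have h2 := interior_subset (hball (show s₁ + s ∈ Metric.ball s₁ δ by simpa using hs)) x hx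
    rw [map_add] at h2
    rw [abs_le] at h1 h2 ⊢
    constructor <;> linarith [h1.1, h1.2, h2.1, h2.2]
  let L : Submodule ℝ E :=
    { carrier := {s | Tendsto (fun x => T x s) l (𝓝 0)}
      add_mem' := fun {a b} ha hb => by simpa using Tendsto.add ha hb
      zero_mem' := by simpa using tendsto_const_nhds
      smul_mem' := fun c s hs => by simpa using Tendsto.const_mul c hs }
  have hLclosed : IsClosed (L : Set E) := by
    refine isClosed_of_closure_subset fun s hs => ?_
    refine Metric.tendsto_nhds.2 fun ε hε => ?_
    obtain ⟨s', hs', hss'⟩ := Metric.mem_closure_iff.1 hs (δ * (ε / 4)) (by positivity)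
    filter_upwards [(Metric.tendsto_nhds.1 hs') (ε / 2) (by positivity), hU.mem k] with x hx hxU
    have h1 := hbound x hxU ((ε / 4)⁻¹ • (s - s')) (by
      rw [norm_smul, Real.norm_of_nonneg (by positivity), ← dist_eq_norm,
        inv_mul_lt_iff₀ (by positivity)]
      linarith)
    rw [map_smul, smul_eq_mul, abs_mul, abs_of_pos (by positivity),
      inv_mul_le_iff₀ (by positivity), map_sub] at h1
    rw [Real.dist_0_eq_abs] at hx ⊢
    have := abs_sub_abs_le_abs_sub (T x s) (T x s')
    linarith
  have hne : (interior (L : Set E)).Nonempty := by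
    by_contra h
    exact hL ((hLclosed.isNowhereDense_iff).2 (not_nonempty_iff_eq_empty.1 h)).isMeagre
  have htop : s₀ ∈ L := by
    rw [L.eq_top_of_nonempty_interior' hne]
    trivial
  exact hs₀ htop

/-- A closed convex set is closed under normalized countable sums with positive weights. -/
theorem Convex.inv_smul_mem_of_hasSum {E : Type*} [AddCommGroup E] [Module ℝ E]
    [TopologicalSpace E] [ContinuousSMul ℝ E] {F : Set E} (hF : Convex ℝ F) (hFc : IsClosed F)
    {w : ℕ → ℝ} (hw : ∀ n, 0 < w n) {c : ℝ} (hc : HasSum w c) {f : ℕ → E} (hf : ∀ n, f n ∈ F)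
    {g : E} (hg : HasSum (fun n => w n • f n) g) : c⁻¹ • g ∈ F := by
  have hcpos : 0 < c := (hw 0).trans_le (le_hasSum hc 0 fun n _ => (hw n).le)
  have hlim := (hc.tendsto_sum_nat.inv₀ hcpos.ne').smul hg.tendsto_sum_nat
  refine hFc.mem_of_tendsto hlim ((eventually_gt_atTop 0).mono fun N hN => ?_)
  exact hF.centerMass_mem (fun n _ => (hw n).le)
    (Finset.sum_pos (fun n _ => hw n) (by simpa using hN.ne')) fun n _ => hf n

/-- In a compact convex set of functions, countably many failures of convergence of single members
can be realized simultaneously by one member. -/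
theorem exists_forall_not_tendsto {X : Type*} {F : Set (X → ℝ)} (hconv : Convex ℝ F)
    (hcomp : IsCompact F) (f : ℕ → X → ℝ) (hf : ∀ n, f n ∈ F) (a : ℕ → X) (l : ℕ → Filter X)
    [∀ n, (l n).IsCountablyGenerated] (h : ∀ n, ¬ Tendsto (f n) (l n) (𝓝 (f n (a n)))) :
    ∃ g ∈ F, ∀ n, ¬ Tendsto g (l n) (𝓝 (g (a n))) := by
  have hM : ∀ x, ∃ M, ∀ n, |f n x| ≤ M := fun x => by
    obtain ⟨M, hM⟩ := (hcomp.image (continuous_apply x)).isBounded.exists_norm_le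
    exact ⟨M, fun n => hM _ (mem_image_of_mem _ (hf n))⟩
  choose M hM using hM
  have hgeom : Summable fun n : ℕ => (1 / 2 : ℝ) ^ n := summable_geometric_two
  have hbd : ∀ x (s : BoundedContinuousFunction ℕ ℝ) n,
      ‖(1 / 2 : ℝ) ^ n * s n * f n x‖ ≤ (1 / 2 : ℝ) ^ n * (M x * ‖s‖) := fun x s n => by
    rw [norm_mul, norm_mul, Real.norm_of_nonneg (by positivity), mul_assoc, mul_comm (M x)]
    gcongr
    · exact s.norm_coe_le_norm n
    · exact hM x n
  have hsum : ∀ x (s : BoundedContinuousFunction ℕ ℝ),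
      Summable fun n => (1 / 2 : ℝ) ^ n * s n * f n x := fun x s =>
    (hgeom.mul_right _).of_norm_bounded (hbd x s)
  let T : X → BoundedContinuousFunction ℕ ℝ →L[ℝ] ℝ := fun x => LinearMap.mkContinuous
    { toFun := fun s => ∑' n, (1 / 2 : ℝ) ^ n * s n * f n x
      map_add' := fun s t => by
        rw [← (hsum x s).tsum_add (hsum x t)]
        exact tsum_congr fun n => by simp only [BoundedContinuousFunction.add_apply]; ring
      map_smul' := fun c s => by
        rw [RingHom.id_apply, smul_eq_mul, ← tsum_mul_left]
        exact tsum_congr fun n => by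
          simp only [BoundedContinuousFunction.coe_smul, smul_eq_mul]; ring }
    (2 * M x) fun s => by
      refine (tsum_of_norm_bounded (hgeom.hasSum.mul_right _) (hbd x s)).trans_eq ?_
      rw [tsum_geometric_two]; ring
  have hT : ∀ x s, HasSum (fun n => (1 / 2 : ℝ) ^ n * s n * f n x) (T x s) :=
    fun x s => (hsum x s).hasSum
  have hmeagre : IsMeagre (⋃ n, {s | Tendsto (fun x => (T x - T (a n)) s) (l n) (𝓝 0)}) := by
    refine isMeagre_iUnion fun n => isMeagre_setOf_tendsto_zero (fun x => T x - T (a n))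
      (s₀ := BoundedContinuousFunction.ofNormedAddCommGroupDiscrete (Pi.single n 1) 1 fun m => by
        by_cases hm : m = n <;> simp [hm]) fun hn => h n ?_
    have hδ : ∀ x, T x (BoundedContinuousFunction.ofNormedAddCommGroupDiscrete (Pi.single n 1) 1
        fun m => by by_cases hm : m = n <;> simp [hm]) = (1 / 2) ^ n * f n x :=
      fun x => (hT x _).unique (by
        convert hasSum_ite_eq n ((1 / 2) ^ n * f n x) using 2 with m
        by_cases hm : m = n <;> simp [hm])
    simp only [_root_.sub_apply, hδ] at hn
    have := (hn.const_mul (2 ^ n)).add_const (f n (a n))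
    simpa [mul_sub] using this
  obtain ⟨s, hs, hsn⟩ : ∃ s ∈ Metric.ball (1 : BoundedContinuousFunction ℕ ℝ) 1,
      s ∉ ⋃ n, {s | Tendsto (fun x => (T x - T (a n)) s) (l n) (𝓝 0)} := by
    by_contra! h
    exact not_isMeagre_of_isOpen Metric.isOpen_ball ⟨1, Metric.mem_ball_self one_pos⟩
      (hmeagre.mono h)
  have hspos : ∀ n, 0 < s n := fun n => by
    have := (BoundedContinuousFunction.dist_coe_le_dist n).trans_lt (Metric.mem_ball.1 hs)
    rw [Real.dist_eq, BoundedContinuousFunction.coe_one, Pi.one_apply, abs_lt] at this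
    linarith [this.1]
  have hws : Summable fun n => (1 / 2 : ℝ) ^ n * s n :=
    (hgeom.mul_right ‖s‖).of_norm_bounded fun n => by
      rw [norm_mul, Real.norm_of_nonneg (by positivity)]
      gcongr
      exact s.norm_coe_le_norm n
  have hc : 0 < ∑' n, (1 / 2 : ℝ) ^ n * s n :=
    hws.tsum_pos (fun n => (mul_pos (by positivity) (hspos n)).le) 0
      (mul_pos (by positivity) (hspos 0))
  refine ⟨_, hconv.inv_smul_mem_of_hasSum hcomp.isClosed
    (fun n => mul_pos (by positivity) (hspos n)) hws.hasSum hf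
    (Pi.hasSum.2 fun x => hT x s), fun n hn => ?_⟩
  refine hsn (mem_iUnion.2 ⟨n, ?_⟩)
  have := (hn.const_mul (∑' n, (1 / 2 : ℝ) ^ n * s n)).sub_const (T (a n) s)
  simp only [Pi.smul_apply, smul_eq_mul, mul_inv_cancel_left₀ hc.ne', sub_self] at this
  exact this

/-- A compact Hausdorff space in which every singleton is a `Gδ` set is first countable. -/
theorem firstCountableTopology_of_isGδ_singleton {X : Type*} [TopologicalSpace X] [CompactSpace X]
    [T2Space X] (h : ∀ x : X, IsGδ ({x} : Set X)) : FirstCountableTopology X := by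
  refine ⟨fun x => ?_⟩
  obtain ⟨U, hUo, hU⟩ := isGδ_iff_eq_iInter_nat.1 (h x)
  have hxU : ∀ n, U n ∈ 𝓝 x := fun n =>
    (hUo n).mem_nhds (mem_iInter.1 (hU ▸ mem_singleton x) n)
  choose C hCx hCc hCU using fun n => exists_mem_nhds_isClosed_subset (hxU n)
  let V : ℕ → Set X := fun n => ⋂ i ∈ Iic n, C i
  have hVc : ∀ n, IsClosed (V n) := fun n => isClosed_biInter fun i _ => hCc i
  have hVx : ∀ n, V n ∈ 𝓝 x := fun n => (biInter_mem (finite_Iic n)).2 fun i _ => hCx i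
  have hVanti : Antitone V := fun m n hmn => biInter_mono (Iic_subset_Iic.2 hmn) fun _ _ => le_rfl
  have hbasis : (𝓝 x).HasBasis (fun _ : ℕ => True) V := by
    refine ⟨fun W => ⟨fun hW => ?_, fun ⟨n, _, hn⟩ => mem_of_superset (hVx n) hn⟩⟩
    obtain ⟨n, hn⟩ := exists_subset_nhds_of_isCompact' (V := V) (U := W)
      (directed_of_isDirected_le hVanti) (fun n => (hVc n).isCompact) hVc fun y hy => by
        have hy' : y ∈ ({x} : Set X) := by
          rw [hU]
          exact mem_iInter.2 fun n => hCU n (mem_iInter₂.1 (mem_iInter.1 hy n) n (mem_Iic.2 le_rfl))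
        rwa [mem_singleton_iff.1 hy']
    exact ⟨n, trivial, hn⟩
  exact isCountablyGenerated_of_seq ⟨V, hbasis.eq_iInf.trans (by simp)⟩

/-- In a first countable space, each compact convex set of scatteredly continuous functions is a
scatteredly continuous family. -/
theorem scatteredlyContinuousFamily_of_isCompact_of_convex {X : Type*} [TopologicalSpace X]
    [FirstCountableTopology X] {F : Set (X → ℝ)} (hFsub : F ⊆ SCp X) (hconv : Convex ℝ F)
    (hcomp : IsCompact F) : ScatteredlyContinuousFamily F := by
  rintro A ⟨a₀, ha₀⟩
  by_contra! h
  have hseq : ∀ a, ∃ f ∈ F, ∃ u : ℕ → X, (∀ k, u k ∈ A) ∧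
      (a ∈ A → Tendsto u atTop (𝓝 a) ∧ ¬ Tendsto (f ∘ u) atTop (𝓝 (f a))) := fun a => by
    by_cases ha : a ∈ A
    · obtain ⟨f, hf, hfa⟩ := h a ha
      obtain ⟨W, hW, hfW⟩ := not_tendsto_iff_exists_frequently_notMem.1 hfa
      obtain ⟨u, hu, huW⟩ := exists_seq_forall_of_frequently
        (hfW.and_eventually self_mem_nhdsWithin)
      refine ⟨f, hf, u, fun k => (huW k).2, fun _ =>
        ⟨hu.mono_right nhdsWithin_le_nhds, fun hlim => ?_⟩⟩
      obtain ⟨k, hk⟩ := (hlim.eventually_mem hW).exists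
      exact (huW k).1 hk
    · obtain ⟨f, hf, -⟩ := h a₀ ha₀
      exact ⟨f, hf, fun _ => a₀, fun _ => ha₀, fun ha' => absurd ha' ha⟩
  choose f hfF u huA hu using hseq
  let q : List ℕ → X := fun L => L.foldr (fun k a => u a k) a₀
  have hqA : ∀ L, q L ∈ A := fun L => by
    cases L with
    | nil => exact ha₀
    | cons k L => exact huA _ k
  let a : ℕ → X := fun n => q (Denumerable.ofNat (List ℕ) n)
  have hrange : range a = range q :=
    (Denumerable.eqv (List ℕ)).symm.surjective.range_comp q
  obtain ⟨g, hgF, hg⟩ := exists_forall_not_tendsto hconv hcomp (fun n => f (a n))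
    (fun n => hfF _) a (fun n => 𝓝[range q] (a n)) fun n hn => by
      obtain ⟨h1, h2⟩ := hu (a n) (hqA _)
      exact h2 (hn.comp (tendsto_nhdsWithin_iff.2 ⟨h1, Eventually.of_forall fun k =>
        ⟨k :: Denumerable.ofNat (List ℕ) n, rfl⟩⟩))
  obtain ⟨b, hb, hgb⟩ := hFsub hgF (range q) ⟨_, mem_range_self []⟩
  obtain ⟨n, rfl⟩ := hrange ▸ hb
  exact hg n hgb

/-- A scatteredly continuous family of real-valued functions is continuous on a nonempty relatively
open subset of every nonempty set. -/
theorem ScatteredlyContinuousFamily.exists_isOpen_continuousWithinAt {X : Type*}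
    [TopologicalSpace X] {F : Set (X → ℝ)} (hF : ScatteredlyContinuousFamily F) {A : Set X}
    (hA : A.Nonempty) :
    ∃ V, IsOpen V ∧ (V ∩ A).Nonempty ∧ ∀ x ∈ V ∩ A, ∀ f ∈ F, ContinuousWithinAt f A x := by
  by_contra! H
  let P : Set X := {x ∈ A | ∃ f ∈ F, ¬ ContinuousWithinAt f A x}
  have hP : ∀ V, IsOpen V → (V ∩ A).Nonempty → (V ∩ P).Nonempty := fun V hV hne => by
    obtain ⟨x, hx, f, hf, hfx⟩ := H V hV hne
    exact ⟨x, hx.1, hx.2, f, hf, hfx⟩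
  obtain ⟨y, hyP, hy⟩ := hF P ((hP univ isOpen_univ (by simpa using hA)).mono inter_subset_right)
  obtain ⟨hyA, f, hf, hfy⟩ := hyP
  refine hfy (Metric.tendsto_nhds.2 fun ε hε => ?_)
  obtain ⟨U, hU, hyU, hUP⟩ := mem_nhdsWithin.1
    ((Metric.tendsto_nhds.1 (hy f hf)) (ε / 2) (by positivity))
  refine mem_nhdsWithin.2 ⟨U, hU, hyU, fun z ⟨hzU, hzA⟩ => ?_⟩
  by_cases hzP : z ∈ P
  · exact lt_trans (b := ε / 2) (hUP ⟨hzU, hzP⟩) (by linarith)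
  have hz : ContinuousWithinAt f A z := by
    by_contra hz
    exact hzP ⟨hzA, f, hf, hz⟩
  obtain ⟨O, hO, hzO, hOA⟩ := mem_nhdsWithin.1 ((Metric.tendsto_nhds.1 hz) (ε / 2) (by positivity))
  obtain ⟨d, ⟨hdU, hdO⟩, hdP⟩ := hP (U ∩ O) (hU.inter hO) ⟨z, ⟨hzU, hzO⟩, hzA⟩
  have h1 : dist (f d) (f y) < ε / 2 := hUP ⟨hdU, hdP⟩
  have h2 : dist (f d) (f z) < ε / 2 := hOA ⟨hdO, hdP.1⟩
  change dist (f z) (f y) < ε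
  linarith [dist_triangle_left (f z) (f y) (f d)]

/-- If a compact set of continuous functions has large oscillation on every nonempty open set, then
two of its members are far apart somewhere in a given open set although they almost agree on a given
finite set. -/
theorem exists_dist_lt_and_lt_dist_of_oscillation {K : Type*} [TopologicalSpace K]
    {F : Set (K → ℝ)} (hF : IsCompact F) (hFc : ∀ f ∈ F, Continuous f) {ε : ℝ} (hε : 0 < ε)
    (H : ∀ V : Set K, IsOpen V → V.Nonempty → ∃ f ∈ F, ∃ x ∈ V, ∃ y ∈ V, ε < dist (f x) (f y))
    {V : Set K} (hV : IsOpen V) (hne : V.Nonempty) (S : Finset K) {δ : ℝ} (hδ : 0 < δ) :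
    ∃ f ∈ F, ∃ g ∈ F, (∀ s ∈ S, dist (f s) (g s) < δ) ∧ ∃ x ∈ V, ε / 3 < dist (f x) (g x) := by
  by_contra! h
  obtain ⟨t, htF, ht⟩ := hF.elim_nhds_subcover (fun g => {f | ∀ s ∈ S, dist (f s) (g s) < δ})
    fun g _ => (Finset.eventually_all S).2 fun s _ =>
      (Metric.tendsto_nhds.1 ((continuous_apply s).tendsto g)) δ hδ
  obtain ⟨z, hz⟩ := hne
  obtain ⟨f, hf, x, hx, y, hy, hxy⟩ := H (V ∩ ⋂ g ∈ t, {x | dist (g x) (g z) < ε / 6})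
    (hV.inter (isOpen_biInter_finset fun g hg =>
      isOpen_lt ((hFc g (htF g hg)).dist continuous_const) continuous_const))
    ⟨z, hz, mem_iInter₂.2 fun g _ => by simpa using by positivity⟩
  obtain ⟨g, hg, hfg⟩ := mem_iUnion₂.1 (ht hf)
  have h1 := h f hf g (htF g hg) hfg x hx.1
  have h2 := h f hf g (htF g hg) hfg y hy.1
  have h3 : dist (g x) (g z) < ε / 6 := mem_iInter₂.1 hx.2 g hg
  have h4 : dist (g y) (g z) < ε / 6 := mem_iInter₂.1 hy.2 g hg
  have h5 := dist_triangle_right (g x) (g y) (g z)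
  have h6 := dist_triangle4 (f x) (g x) (g y) (f y)
  rw [dist_comm (g y) (f y)] at h6
  linarith

/-- A pointwise compact set of continuous functions on a compact Hausdorff space has small
oscillation on some nonempty open set. -/
theorem exists_isOpen_forall_dist_le_of_isCompact {K : Type*} [TopologicalSpace K] [CompactSpace K]
    [T2Space K] [Nonempty K] {F : Set (K → ℝ)} (hF : IsCompact F) (hFc : ∀ f ∈ F, Continuous f)
    {ε : ℝ} (hε : 0 < ε) :
    ∃ V : Set K, IsOpen V ∧ V.Nonempty ∧ ∀ f ∈ F, ∀ x ∈ V, ∀ y ∈ V, dist (f x) (f y) ≤ ε := by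
  by_contra! H
  have step : ∀ (n : ℕ) (p : {p : Set K × Finset K // (interior p.1).Nonempty}),
      ∃ f ∈ F, ∃ g ∈ F, ∃ x, ∃ p' : {p : Set K × Finset K // (interior p.1).Nonempty},
        (∀ s ∈ p.1.2, dist (f s) (g s) < 1 / ((n : ℝ) + 1)) ∧ IsClosed p'.1.1 ∧
        p'.1.1 ⊆ p.1.1 ∧ x ∈ p'.1.1 ∧ p.1.2 ⊆ p'.1.2 ∧ x ∈ p'.1.2 ∧
        ∀ y ∈ p'.1.1, ε / 3 < dist (f y) (g y) := by
    classical
    rintro n ⟨⟨V, S⟩, hV⟩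
    obtain ⟨f, hf, g, hg, hS, x, hx, hfg⟩ := exists_dist_lt_and_lt_dist_of_oscillation hF hFc hε H
      isOpen_interior hV S (Nat.one_div_pos_of_nat (α := ℝ) (n := n))
    obtain ⟨C, hCx, hC, hCV⟩ := exists_mem_nhds_isClosed_subset
      ((isOpen_interior.inter (isOpen_lt continuous_const ((hFc f hf).dist (hFc g hg)))).mem_nhds
        ⟨hx, hfg⟩)
    exact ⟨f, hf, g, hg, x, ⟨(C, insert x S), x, mem_interior_iff_mem_nhds.2 hCx⟩, hS, hC,
      fun y hy => interior_subset (hCV hy).1, mem_of_mem_nhds hCx, Finset.subset_insert _ _,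
      Finset.mem_insert_self _ _, fun y hy => (hCV hy).2⟩
  choose f hf g hg x next hS hC hsub hx hSS hxS hfar using step
  let p : ℕ → {p : Set K × Finset K // (interior p.1).Nonempty} :=
    fun n => Nat.rec ⟨(univ, ∅), by simp⟩ next n
  have hVanti : Antitone fun n => (p n).1.1 := antitone_nat_of_succ_le fun n => hsub n (p n)
  have hSmono : Monotone fun n => (p n).1.2 := monotone_nat_of_le_succ fun n => hSS n (p n)
  let l : Ultrafilter ℕ := hyperfilter ℕ
  have hl : (l : Filter ℕ) ≤ atTop := Nat.hyperfilter_le_atTop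
  have hlim : ∀ h : ℕ → K → ℝ, (∀ n, h n ∈ F) → ∃ h' ∈ F, Tendsto h l (𝓝 h') := fun h hh =>
    hF.ultrafilter_le_nhds (l.map h) (le_principal_iff.2 (mem_map.2 (univ_mem' hh)))
  obtain ⟨f', hf', hff'⟩ := hlim (fun n => f n (p n)) fun n => hf n (p n)
  obtain ⟨g', hg', hgg'⟩ := hlim (fun n => g n (p n)) fun n => hg n (p n)
  obtain ⟨z, -, hz⟩ := isCompact_univ.ultrafilter_le_nhds (l.map fun n => x n (p n)) (by simp)
  replace hz : Tendsto (fun n => x n (p n)) l (𝓝 z) := hz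
  have heval : ∀ y, Tendsto (fun n => dist (f n (p n) y) (g n (p n) y)) l (𝓝 (dist (f' y) (g' y))) :=
    fun y => (tendsto_pi_nhds.1 hff' y).dist (tendsto_pi_nhds.1 hgg' y)
  have heq : ∀ m, f' (x m (p m)) = g' (x m (p m)) := fun m => by
    refine dist_le_zero.1 (le_of_tendsto_of_tendsto (heval _)
      (tendsto_one_div_add_atTop_nhds_zero_nat.mono_left hl) (hl ?_))
    filter_upwards [eventually_ge_atTop (m + 1)] with n hn
    exact (hS n (p n) _ (hSmono hn (hxS m (p m)))).le
  have hfgz : f' z = g' z := tendsto_nhds_unique (((hFc f' hf').tendsto z).comp hz)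
    ((((hFc g' hg').tendsto z).comp hz).congr fun m => (heq m).symm)
  have hzV : ∀ n, z ∈ (p (n + 1)).1.1 := fun n =>
    (hC n (p n)).mem_of_tendsto hz (hl ((eventually_ge_atTop n).mono fun m hm =>
      hVanti (Nat.succ_le_succ hm) (hx m (p m))))
  have := ge_of_tendsto (heval z) (Eventually.of_forall fun n => (hfar n (p n) z (hzV n)).le)
  rw [hfgz, dist_self] at this
  linarith

/-- Over a closed subset of a compact Hausdorff space, a compact scatteredly continuous family of
real-valued functions has small oscillation on some nonempty relatively open subset. -/
theorem ScatteredlyContinuousFamily.exists_isOpen_forall_dist_le {X : Type*} [TopologicalSpace X]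
    [CompactSpace X] [T2Space X] {F : Set (X → ℝ)} (hF : ScatteredlyContinuousFamily F)
    (hcomp : IsCompact F) {A : Set X} (hA : IsClosed A) (hne : A.Nonempty) {ε : ℝ} (hε : 0 < ε) :
    ∃ V, IsOpen V ∧ (V ∩ A).Nonempty ∧
      ∀ f ∈ F, ∀ x ∈ V ∩ A, ∀ y ∈ V ∩ A, dist (f x) (f y) ≤ ε := by
  obtain ⟨V, hV, ⟨a, haV, haA⟩, hcont⟩ := hF.exists_isOpen_continuousWithinAt hne
  obtain ⟨C, hCa, hC, hCV⟩ := exists_mem_nhds_isClosed_subset (hV.mem_nhds haV)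
  let K : Set X := closure (interior C ∩ A)
  have haK : a ∈ interior C ∩ A := ⟨mem_interior_iff_mem_nhds.2 hCa, haA⟩
  have hKC : K ⊆ C ∩ A := closure_minimal (inter_subset_inter_left _ interior_subset) (hC.inter hA)
  have : CompactSpace K := isCompact_iff_compactSpace.1 isClosed_closure.isCompact
  have : Nonempty K := ⟨⟨a, subset_closure haK⟩⟩
  obtain ⟨W, hW, ⟨w, hw⟩, hsmall⟩ := exists_isOpen_forall_dist_le_of_isCompact
    (hcomp.image (f := fun (f : X → ℝ) (x : K) => f x) (by fun_prop)) (by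
      rintro _ ⟨f, hf, rfl⟩
      exact continuousOn_iff_continuous_domRestrict.1 fun x hx =>
        (hcont x ⟨hCV (hKC hx).1, (hKC hx).2⟩ f hf).mono (hKC.trans inter_subset_right)) hε
  obtain ⟨O, hO, rfl⟩ := isOpen_induced_iff.1 hW
  obtain ⟨b, hbO, hbC, hbA⟩ := mem_closure_iff.1 w.2 O hO hw
  refine ⟨O ∩ interior C, hO.inter isOpen_interior, ⟨b, ⟨hbO, hbC⟩, hbA⟩, ?_⟩
  rintro f hf x ⟨⟨hxO, hxC⟩, hxA⟩ y ⟨⟨hyO, hyC⟩, hyA⟩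
  exact hsmall _ (mem_image_of_mem _ hf) ⟨x, subset_closure ⟨hxC, hxA⟩⟩ hxO
    ⟨y, subset_closure ⟨hyC, hyA⟩⟩ hyO

/-- In a space all of whose open subsets are Lindelöf, a monotone and countably additive property
that holds locally somewhere on every nonempty closed subset holds for the whole space. -/
theorem of_forall_isClosed_exists_isOpen_inter {X : Type*} [TopologicalSpace X]
    (hL : ∀ W : Set X, IsOpen W → IsLindelof W) {p : Set X → Prop}
    (hmono : ∀ ⦃s t⦄, s ⊆ t → p t → p s)
    (hunion : ∀ S : Set (Set X), S.Countable → (∀ s ∈ S, p s) → p (⋃₀ S))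
    (hp : ∀ A, IsClosed A → A.Nonempty → ∃ V, IsOpen V ∧ (V ∩ A).Nonempty ∧ p (V ∩ A)) :
    p univ := by
  let W : Set X := ⋃₀ {V | IsOpen V ∧ p V}
  have hW : IsOpen W := isOpen_sUnion fun V hV => hV.1
  have hpW : p W := (hL W hW).induction_on hmono hunion fun x ⟨V, hV, hxV⟩ =>
    ⟨V, mem_nhdsWithin_of_mem_nhds (hV.1.mem_nhds hxV), hV.2⟩
  suffices Wᶜ = ∅ by rwa [← compl_empty_iff.1 this]
  by_contra hne
  obtain ⟨V, hV, ⟨x, hxV, hxW⟩, hpV⟩ := hp Wᶜ hW.isClosed_compl (nonempty_iff_ne_empty.2 hne)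
  refine hxW ⟨V, ⟨hV, ?_⟩, hxV⟩
  refine hmono (t := ⋃₀ {W, V ∩ Wᶜ}) (fun y hy => ?_) (hunion _ (by simp) (by simp [hpW, hpV]))
  by_cases hyW : y ∈ W <;> simp [hy, hyW]

/-- For a perfectly normal compact Hausdorff space `X`, each compact convex subset of the
function space `SC_p(X)` is metrizable. -/
theorem compact_convex_subset_SCp_metrizable
    {X : Type u} [TopologicalSpace X] [CompactSpace X] [T2Space X]
    (hnorm : NormalSpace X) (hGδ : ∀ C : Set X, IsClosed C → IsGδ C)
    (F : Set (X → ℝ)) (hFsub : F ⊆ SCp X) (hconv : Convex ℝ F) (hcomp : IsCompact F) :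
    TopologicalSpace.MetrizableSpace ↥F := by
  have : FirstCountableTopology X :=
    firstCountableTopology_of_isGδ_singleton fun x => hGδ {x} isClosed_singleton
  have hfam := scatteredlyContinuousFamily_of_isCompact_of_convex hFsub hconv hcomp
  have hL : ∀ W : Set X, IsOpen W → IsLindelof W := fun W hW => by
    obtain ⟨U, hU, hWU⟩ := isGδ_iff_eq_iInter_nat.1 (hGδ Wᶜ hW.isClosed_compl)
    rw [← compl_compl W, hWU, compl_iInter]
    exact isLindelof_iUnion fun n => (hU n).isClosed_compl.isCompact.isLindelof
  have hnet : ∀ n : ℕ, ∃ D : Set X, D.Countable ∧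
      ∀ x ∈ univ, ∃ d ∈ D, ∀ f ∈ F, dist (f x) (f d) ≤ 1 / ((n : ℝ) + 1) := fun n => by
    refine of_forall_isClosed_exists_isOpen_inter hL
      (p := fun s => ∃ D : Set X, D.Countable ∧
        ∀ x ∈ s, ∃ d ∈ D, ∀ f ∈ F, dist (f x) (f d) ≤ 1 / ((n : ℝ) + 1)) ?_ ?_ ?_
    · rintro s t hst ⟨D, hD, h⟩
      exact ⟨D, hD, fun x hx => h x (hst hx)⟩
    · intro S hS h
      choose! D hD hDs using h
      refine ⟨⋃ s ∈ S, D s, hS.biUnion hD, ?_⟩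
      rintro x ⟨s, hs, hx⟩
      obtain ⟨d, hd, h⟩ := hDs s hs x hx
      exact ⟨d, mem_biUnion hs hd, h⟩
    · intro A hA hne
      obtain ⟨V, hV, ⟨d, hd⟩, h⟩ := hfam.exists_isOpen_forall_dist_le hcomp hA hne
        (Nat.one_div_pos_of_nat (α := ℝ) (n := n))
      exact ⟨V, hV, ⟨d, hd⟩, {d}, countable_singleton d, fun x hx =>
        ⟨d, rfl, fun f hf => h f hf x hx d hd⟩⟩
  choose D hD hDx using hnet
  have : Countable (⋃ n, D n) := (countable_iUnion hD).to_subtype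
  have : CompactSpace F := isCompact_iff_compactSpace.1 hcomp
  let r : F → (⋃ n, D n : Set X) → ℝ := fun f d => f.1 d
  have hr : Continuous r :=
    continuous_pi fun d => (continuous_apply d.1).comp continuous_subtype_val
  have hinj : Function.Injective r := by
    refine fun f g hfg => Subtype.ext (funext fun x => dist_le_zero.1 ?_)
    have hlim : Tendsto (fun n : ℕ => 2 * (1 / ((n : ℝ) + 1))) atTop (𝓝 0) := by
      simpa only [mul_zero] using tendsto_one_div_add_atTop_nhds_zero_nat.const_mul (2 : ℝ)
    refine ge_of_tendsto' hlim fun n => ?_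
    obtain ⟨d, hd, h⟩ := hDx n x (mem_univ x)
    have hfgd : f.1 d = g.1 d := congrFun hfg ⟨d, mem_iUnion.2 ⟨n, hd⟩⟩
    have hf := h f f.2
    have hg := h g g.2
    rw [hfgd] at hf
    linarith [dist_triangle_right (f.1 x) (g.1 x) (g.1 d)]
  exact (hr.isClosedEmbedding hinj).isEmbedding.metrizableSpace
end
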